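/- Let (X0,Y0) ∈ PPS be strongly efficient with all components positive and suppose (X0,Y0) is not of the directional smallest scale size, with witness η* > 0 and β* ∈ ℝ such that (Ω_{−η*} X0, Φ_{−β*} Y0) ∈ PPS. Then for every t ∈ (0, η*] there exists β ∈ ℝ (namely β = (t/η*)·β*) such that (Ω_{−t} X0, Φ_{−β} Y0) ∈ PPS; in particular the left-hand feasibility problem is solvable for every t ∈ (0, η*]. -/

import Mathlib

open Finset Set

/-- The production possibility set (variable returns to scale):
`(X, Y) ∈ PPS` iff there are convex weights `lam` with
`Σ_j lam_j X_j ≤ X` and `Y ≤ Σ_j lam_j Y_j` componentwise. -/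
def PPS {m s n : ℕ} (X : Fin n → Fin m → ℝ) (Y : Fin n → Fin s → ℝ) :
    Set ((Fin m → ℝ) × (Fin s → ℝ)) :=
  {p | ∃ lam : Fin n → ℝ, (∀ j, 0 ≤ lam j) ∧ (∑ j, lam j) = 1 ∧
    (∀ i, ∑ j, lam j * X j i ≤ p.1 i) ∧ (∀ r, p.2 r ≤ ∑ j, lam j * Y j r)}

/-- Weak efficiency: no point of PPS strictly dominates in every coordinate. -/
def WeaklyEfficient {m s n : ℕ} (X : Fin n → Fin m → ℝ) (Y : Fin n → Fin s → ℝ)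
    (p : (Fin m → ℝ) × (Fin s → ℝ)) : Prop :=
  p ∈ PPS X Y ∧ ¬ ∃ q ∈ PPS X Y, (∀ i, q.1 i < p.1 i) ∧ (∀ r, p.2 r < q.2 r)

/-- Strong (Pareto) efficiency. -/
def StronglyEfficient {m s n : ℕ} (X : Fin n → Fin m → ℝ) (Y : Fin n → Fin s → ℝ)
    (p : (Fin m → ℝ) × (Fin s → ℝ)) : Prop :=
  p ∈ PPS X Y ∧ ¬ ∃ q ∈ PPS X Y, (∀ i, q.1 i ≤ p.1 i) ∧ (∀ r, p.2 r ≤ q.2 r) ∧ q ≠ p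

/-- `(V, U, μ0)` is a supporting hyperplane of PPS at the point `p0`. -/
def SupportingHyperplane {m s n : ℕ} (X : Fin n → Fin m → ℝ) (Y : Fin n → Fin s → ℝ)
    (p0 : (Fin m → ℝ) × (Fin s → ℝ)) (V : Fin m → ℝ) (U : Fin s → ℝ) (μ0 : ℝ) : Prop :=
  (¬ (V = 0 ∧ U = 0)) ∧
  ((∑ r, U r * p0.2 r) - (∑ i, V i * p0.1 i) + μ0 = 0) ∧
  (∀ p ∈ PPS X Y, (∑ r, U r * p.2 r) - (∑ i, V i * p.1 i) + μ0 ≤ 0)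

/-- `Ω_t X0 = ((1 + ω_i t) x_{i0})_i`. -/
noncomputable def scaleX {m : ℕ} (ω : Fin m → ℝ) (t : ℝ) (X0 : Fin m → ℝ) : Fin m → ℝ :=
  fun i => (1 + ω i * t) * X0 i

/-- `Φ_β Y0 = ((1 + δ_r β) y_{r0})_r`. -/
noncomputable def scaleY {s : ℕ} (δ : Fin s → ℝ) (β : ℝ) (Y0 : Fin s → ℝ) : Fin s → ℝ :=
  fun r => (1 + δ r * β) * Y0 r

/-- `(X0, Y0)` is of the directional smallest scale size:
`(Ω_t X0, Φ_β Y0) ∉ PPS` for every `t < 0` and every `β`. -/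
def DSSS {m s n : ℕ} (X : Fin n → Fin m → ℝ) (Y : Fin n → Fin s → ℝ)
    (ω : Fin m → ℝ) (δ : Fin s → ℝ) (X0 : Fin m → ℝ) (Y0 : Fin s → ℝ) : Prop :=
  ∀ t < (0 : ℝ), ∀ β : ℝ, (scaleX ω t X0, scaleY δ β Y0) ∉ PPS X Y

/-- Feasible region `F` of the fractional program (Model 28): triples `(U, V, μ0)`. -/
def Fset {m s n : ℕ} (X : Fin n → Fin m → ℝ) (Y : Fin n → Fin s → ℝ)
    (X0 : Fin m → ℝ) (Y0 : Fin s → ℝ) : Set ((Fin s → ℝ) × (Fin m → ℝ) × ℝ) :=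
  {p | (∀ r, 0 ≤ p.1 r) ∧ (∀ i, 0 ≤ p.2.1 i) ∧
    (∀ j, (∑ r, p.1 r * Y j r) - (∑ i, p.2.1 i * X j i) + p.2.2 ≤ 0) ∧
    ((∑ r, p.1 r * Y0 r) - (∑ i, p.2.1 i * X0 i) + p.2.2 = 0) ∧
    ((∑ i, p.2.1 i * X0 i) = 1)}

/-- The fractional objective `(Σ_i v_i ω_i x_{i0}) / (Σ_r u_r δ_r y_{r0})` of Model (28). -/
noncomputable def seRatio {m s : ℕ} (ω : Fin m → ℝ) (δ : Fin s → ℝ)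
    (X0 : Fin m → ℝ) (Y0 : Fin s → ℝ) (p : (Fin s → ℝ) × (Fin m → ℝ) × ℝ) : ℝ :=
  (∑ i, p.2.1 i * ω i * X0 i) / (∑ r, p.1 r * δ r * Y0 r)

/-- Feasible region `G` of the linear program (Model 33): tuples `(Γ, Λ, τ, μ0')`. -/
def Gset {m s n : ℕ} (X : Fin n → Fin m → ℝ) (Y : Fin n → Fin s → ℝ)
    (ω : Fin m → ℝ) (δ : Fin s → ℝ) (X0 : Fin m → ℝ) (Y0 : Fin s → ℝ) :
    Set ((Fin m → ℝ) × (Fin s → ℝ) × ℝ × ℝ) :=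
  {q | (∀ i, 0 ≤ q.1 i) ∧ (∀ r, 0 ≤ q.2.1 r) ∧ 0 ≤ q.2.2.1 ∧
    (∀ j, (∑ r, q.2.1 r / δ r * Y j r) - (∑ i, q.1 i / ω i * X j i) + q.2.2.2 ≤ 0) ∧
    ((∑ r, q.2.1 r / δ r * Y0 r) - (∑ i, q.1 i / ω i * X0 i) + q.2.2.2 = 0) ∧
    ((∑ i, q.1 i / ω i * X0 i) = q.2.2.1) ∧
    ((∑ r, q.2.1 r * Y0 r) = 1)}

/-- The production possibility set is convex. -/
theorem convex_PPS {m s n : ℕ} (X : Fin n → Fin m → ℝ) (Y : Fin n → Fin s → ℝ) :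
    Convex ℝ (PPS X Y) := by
  rintro p ⟨l, hl, hl1, hlX, hlY⟩ q ⟨k, hk, hk1, hkX, hkY⟩ a b ha hb hab
  have combine : ∀ f : Fin n → ℝ,
      ∑ j, (a * l j + b * k j) * f j = a * ∑ j, l j * f j + b * ∑ j, k j * f j := by
    intro f
    simp only [add_mul, mul_assoc, Finset.sum_add_distrib, Finset.mul_sum]
  refine ⟨fun j => a * l j + b * k j, fun j => ?_, ?_, fun i => ?_, fun r => ?_⟩
  · exact add_nonneg (mul_nonneg ha (hl j)) (mul_nonneg hb (hk j))
  · simpa [hl1, hk1, hab] using combine fun _ => 1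
  · rw [combine]
    exact add_le_add (mul_le_mul_of_nonneg_left (hlX i) ha) (mul_le_mul_of_nonneg_left (hkX i) hb)
  · rw [combine]
    exact add_le_add (mul_le_mul_of_nonneg_left (hlY r) ha) (mul_le_mul_of_nonneg_left (hkY r) hb)

/-- If (X0, Y0) is not of the directional smallest scale size, witnessed at η* > 0,
then the left-hand feasibility problem is solvable for every t ∈ (0, η*],
with β = (t/η*)·β*. -/
theorem left_feasibility_for_all_small_t
    {m s n : ℕ} (hm : 1 ≤ m) (hs : 1 ≤ s) (hn : 1 ≤ n)
    (X : Fin n → Fin m → ℝ) (Y : Fin n → Fin s → ℝ)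
    (hX : ∀ j i, 0 < X j i) (hY : ∀ j r, 0 < Y j r)
    (ω : Fin m → ℝ) (δ : Fin s → ℝ)
    (hω : ∀ i, 0 ≤ ω i) (hδ : ∀ r, 0 ≤ δ r)
    (hωsum : (∑ i, ω i) = (m : ℝ)) (hδsum : (∑ r, δ r) = (s : ℝ))
    (X0 : Fin m → ℝ) (Y0 : Fin s → ℝ)
    (hX0 : ∀ i, 0 < X0 i) (hY0 : ∀ r, 0 < Y0 r)
    (hse : StronglyEfficient X Y (X0, Y0))
    (ηstar βstar : ℝ) (hη : 0 < ηstar)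
    (hwit : (scaleX ω (-ηstar) X0, scaleY δ (-βstar) Y0) ∈ PPS X Y) :
    ∀ t ∈ Set.Ioc (0 : ℝ) ηstar,
      (scaleX ω (-t) X0, scaleY δ (-(t / ηstar * βstar)) Y0) ∈ PPS X Y ∧
      ∃ β : ℝ, (scaleX ω (-t) X0, scaleY δ (-β) Y0) ∈ PPS X Y := by
  rintro t ⟨ht, htη⟩
  have key : (scaleX ω (-t) X0, scaleY δ (-(t / ηstar * βstar)) Y0) ∈ PPS X Y := by
    have h := convex_PPS X Y hse.1 hwit (sub_nonneg.2 ((div_le_one hη).2 htη))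
      (div_pos ht hη).le (sub_add_cancel 1 (t / ηstar))
    convert h using 1
    ext i
    · simp only [scaleX, Prod.smul_mk, Prod.mk_add_mk, Pi.add_apply, Pi.smul_apply, smul_eq_mul]
      field_simp
      ring
    · simp only [scaleY, Prod.smul_mk, Prod.mk_add_mk, Pi.add_apply, Pi.smul_apply, smul_eq_mul]
      ring
  exact ⟨key, _, key⟩
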